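/- Let $(R,\mathfrak{m})$ be a commutative noetherian local ring with $\operatorname{depth} R > 0$, and let $M$ be a finitely generated $R$-module with $\operatorname{depth} M > 0$ and $\operatorname{Gdim}_R M = \infty$. Then there exists a finitely generated $R$-module $N$ in the resolving closure of $M$ that is locally free on the punctured spectrum of $R$, with $\operatorname{depth} N > 0$ and $\operatorname{Gdim}_R N = \infty$. -/

import Mathlib

open CategoryTheory IsLocalRing

noncomputable section

/-- The `i`-th Ext group of `R`-modules `M`, `N`, as a `ModuleCat R`. -/
def ExtGroup (R : Type) [CommRing R] (i : ℕ) (M N : ModuleCat.{0} R) : ModuleCat R :=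
  ((Ext R (ModuleCat.{0} R) i).obj (Opposite.op M)).obj N

/-- The `i`-th Tor group. -/
def TorGroup (R : Type) [CommRing R] (i : ℕ) (M N : ModuleCat.{0} R) : ModuleCat R :=
  ((Tor (ModuleCat.{0} R) i).obj M).obj N

/-- `Ext_R^i(M, N) = 0` for all `i ≫ 0`. -/
def ExtEventuallyZero (R : Type) [CommRing R] (M N : ModuleCat.{0} R) : Prop :=
  ∃ t : ℕ, ∀ i > t, Subsingleton (ExtGroup R i M N)

/-- Property (ee). -/
def PropEE (R : Type) [CommRing R] : Prop :=
  ∀ M N : ModuleCat.{0} R, Module.Finite R M → Module.Finite R N →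
    ExtEventuallyZero R M N → ExtEventuallyZero R N M

/-- Gorenstein: `Ext^i(k, R) = 0` for `i ≫ 0`. -/
def IsGorensteinLocalRing (R : Type) [CommRing R] [IsLocalRing R] : Prop :=
  ∃ t : ℕ, ∀ i > t, Subsingleton
    (ExtGroup R i (ModuleCat.of R (ResidueField R)) (ModuleCat.of R R))

open Classical in
/-- depth of a module over a local ring, with depth of zero module = ⊤. -/
def rdepth (R : Type) [CommRing R] [IsLocalRing R]
    (M : Type) [AddCommGroup M] [Module R M] : ℕ∞ :=
  if Subsingleton M then ⊤ else
    sSup {n : ℕ∞ | ∃ rs : List R, (rs.length : ℕ∞) = n ∧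
      (∀ r ∈ rs, r ∈ maximalIdeal R) ∧ RingTheory.Sequence.IsRegular M rs}

/-- Totally reflexive module. -/
def IsTotallyReflexive (R : Type) [CommRing R]
    (M : Type) [AddCommGroup M] [Module R M] : Prop :=
  Module.Finite R M ∧ Function.Bijective (Module.Dual.eval R M) ∧
  (∀ i > 0, Subsingleton (ExtGroup R i (ModuleCat.of R M) (ModuleCat.of R R))) ∧
  (∀ i > 0, Subsingleton
    (ExtGroup R i (ModuleCat.of R (Module.Dual R M)) (ModuleCat.of R R)))

/-- Property (tr). -/
def PropTR (R : Type) [CommRing R] : Prop :=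
  ∀ (M : Type) [AddCommGroup M] [Module R M], Module.Finite R M →
    (∀ i > 0, Subsingleton (ExtGroup R i (ModuleCat.of R M) (ModuleCat.of R R))) →
    IsTotallyReflexive R M

/-- Property (dep): the depth formula (written additively to avoid truncated subtraction). -/
def PropDep (R : Type) [CommRing R] [IsLocalRing R] : Prop :=
  ∀ (M N : Type) [AddCommGroup M] [Module R M] [AddCommGroup N] [Module R N],
    Module.Finite R M → Module.Finite R N → Nontrivial M → Nontrivial N →
    (∀ i > 0, Subsingleton (TorGroup R i (ModuleCat.of R M) (ModuleCat.of R N))) →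
    rdepth R (TensorProduct R M N) + rdepth R R = rdepth R M + rdepth R N

/-- AB ring. -/
def IsABRing (R : Type) [CommRing R] [IsLocalRing R] : Prop :=
  IsGorensteinLocalRing R ∧ ∃ n : ℕ, ∀ M N : ModuleCat.{0} R,
    Module.Finite R M → Module.Finite R N → ExtEventuallyZero R M N →
    ∀ i > n, Subsingleton (ExtGroup R i M N)

/-- A complex of finitely generated projective modules, indexed by `ℤ`. -/
structure FGProjComplex (R : Type) [CommRing R] where
  X : ℤ → Type
  [acg : ∀ n, AddCommGroup (X n)]
  [mod : ∀ n, Module R (X n)]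
  [fin : ∀ n, Module.Finite R (X n)]
  [proj : ∀ n, Module.Projective R (X n)]
  d : ∀ n : ℤ, X n →ₗ[R] X (n + 1)
  dd : ∀ n : ℤ, (d (n + 1)).comp (d n) = 0

attribute [instance] FGProjComplex.acg FGProjComplex.mod FGProjComplex.fin FGProjComplex.proj

/-- Acyclicity of such a complex. -/
def FGProjComplex.Acyclic {R : Type} [CommRing R] (C : FGProjComplex R) : Prop :=
  ∀ n : ℤ, LinearMap.ker (C.d (n + 1)) = LinearMap.range (C.d n)

/-- The dual complex is acyclic. -/
def FGProjComplex.DualAcyclic {R : Type} [CommRing R] (C : FGProjComplex R) : Prop :=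
  ∀ n : ℤ, LinearMap.ker ((C.d n).dualMap) = LinearMap.range ((C.d (n + 1)).dualMap)

/-- Property (tac): every acyclic complex of f.g. projective modules is totally acyclic. -/
def PropTAC (R : Type) [CommRing R] : Prop :=
  ∀ C : FGProjComplex R, C.Acyclic → C.DualAcyclic

/-- `M` is an ∞-syzygy. -/
def IsInfiniteSyzygy (R : Type) [CommRing R]
    (M : Type) [AddCommGroup M] [Module R M] : Prop :=
  Module.Finite R M ∧
  ∃ (k : ℕ → ℕ) (f : M →ₗ[R] (Fin (k 0) → R))
    (d : ∀ n : ℕ, (Fin (k n) → R) →ₗ[R] (Fin (k (n + 1)) → R)),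
    Function.Injective f ∧ LinearMap.ker (d 0) = LinearMap.range f ∧
    ∀ n : ℕ, LinearMap.ker (d (n + 1)) = LinearMap.range (d n)

end

noncomputable section

/-- Minimal `n`-th syzygy: `IsMinimalSyzygy R n M K` says `K` is the `n`-th syzygy of `M`
computed from a minimal free resolution. -/
def IsMinimalSyzygy (R : Type) [CommRing R] [IsLocalRing R] :
    ℕ → ModuleCat.{0} R → ModuleCat.{0} R → Prop
  | 0, M, K => Nonempty (K ≃ₗ[R] M)
  | n + 1, M, K => ∃ (m : ℕ) (f : (Fin m → R) →ₗ[R] M),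
      Function.Surjective f ∧
      (LinearMap.ker f ≤ (maximalIdeal R) • (⊤ : Submodule R (Fin m → R))) ∧
      IsMinimalSyzygy R n (ModuleCat.of R (LinearMap.ker f)) K

/-- A resolving class of modules: contains `R`, closed under isomorphisms, direct summands,
extensions and syzygies. -/
def IsResolvingClass (R : Type) [CommRing R] (P : ModuleCat.{0} R → Prop) : Prop :=
  (P (ModuleCat.of R R)) ∧
  (∀ X Y : ModuleCat.{0} R, Nonempty (X ≃ₗ[R] Y) → P X → P Y) ∧
  (∀ (X Y : ModuleCat.{0} R) (i : X →ₗ[R] Y) (r : Y →ₗ[R] X),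
      r.comp i = LinearMap.id → P Y → P X) ∧
  (∀ (X Y Z : ModuleCat.{0} R) (f : X →ₗ[R] Y) (g : Y →ₗ[R] Z),
      Function.Injective f → Function.Surjective g → LinearMap.ker g = LinearMap.range f →
      P X → P Z → P Y) ∧
  (∀ (X Y : ModuleCat.{0} R) (m : ℕ) (f : (Fin m → R) →ₗ[R] X), Function.Surjective f →
      Nonempty (Y ≃ₗ[R] LinearMap.ker f) → P X → P Y)

/-- `N` belongs to the resolving closure `res M`. -/
def InResolvingClosure (R : Type) [CommRing R] (M N : ModuleCat.{0} R) : Prop :=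
  ∀ P : ModuleCat.{0} R → Prop, IsResolvingClass R P → P M → P N

/-- `M` has finite G-dimension: it admits a finite resolution by totally reflexive modules. -/
def HasFiniteGDim (R : Type) [CommRing R] (M : Type) [AddCommGroup M] [Module R M] : Prop :=
  ∃ (n : ℕ) (T : ℕ → ModuleCat.{0} R) (d : ∀ i : ℕ, T (i + 1) →ₗ[R] T i) (ε : T 0 →ₗ[R] M),
    (∀ i, IsTotallyReflexive R (T i)) ∧ Function.Surjective ε ∧
    LinearMap.ker ε = LinearMap.range (d 0) ∧
    (∀ i, LinearMap.ker (d i) = LinearMap.range (d (i + 1))) ∧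
    (∀ i > n, Subsingleton (T i))

/-- `ω` is a canonical module of the `d`-dimensional Cohen–Macaulay local ring `R`:
`Ext^i(k, ω)` vanishes for `i ≠ d` and is isomorphic to `k` for `i = d`. -/
def IsCanonicalModule (R : Type) [CommRing R] [IsLocalRing R] (d : ℕ)
    (ω : ModuleCat.{0} R) : Prop :=
  Module.Finite R ω ∧
  (∀ i : ℕ, i ≠ d → Subsingleton (ExtGroup R i (ModuleCat.of R (ResidueField R)) ω)) ∧
  Nonempty ((ExtGroup R d (ModuleCat.of R (ResidueField R)) ω) ≃ₗ[R] (ResidueField R))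

/-- Cohen–Macaulay local ring: depth equals Krull dimension. -/
def IsCohenMacaulayLocalRing (R : Type) [CommRing R] [IsLocalRing R] : Prop :=
  (rdepth R R : WithBot ℕ∞) = ringKrullDim R

end

/-- Vanishing of `Ext^i(A, R)`, in terms of the derived category model of `Ext`. -/
def ExtVanishes (R : Type) [CommRing R] (i : ℕ) (A : Type) [AddCommGroup A] [Module R A] : Prop :=
  Subsingleton (Abelian.Ext.{0} (ModuleCat.of R A) (ModuleCat.of R R) i)

lemma subsingleton_extGroup_succ_iff {R : Type} [CommRing R] (A B : ModuleCat.{0} R) (i : ℕ) :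
    Subsingleton (ExtGroup R (i + 1) A B) ↔ Subsingleton (Abelian.Ext.{0} A B (i + 1)) := by
  let P := ProjectiveResolution.of A
  have hP : Subsingleton (ExtGroup R (i + 1) A B) ↔
      (P.complex.linearYonedaObj R B).ExactAt (i + 1) := by
    rw [HomologicalComplex.exactAt_iff_isZero_homology, ← ModuleCat.isZero_iff_subsingleton]
    exact (P.isoExt (i + 1) B).isZero_iff
  rw [hP, HomologicalComplex.exactAt_iff' _ i (i + 1) (i + 2) (by simp) (by simp),
    ShortComplex.moduleCat_exact_iff]
  constructor
  · intro h
    refine subsingleton_of_forall_eq 0 fun e ↦ ?_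
    obtain ⟨f, hf, rfl⟩ := P.extMk_surjective e (i + 2) rfl
    rw [P.extMk_eq_zero_iff f (i + 2) rfl hf i rfl]
    exact h f hf
  · intro h f hf
    have := (P.extMk_eq_zero_iff f (i + 2) rfl hf i rfl).1 (Subsingleton.elim _ _)
    exact this

section LongExactSequence

variable {R : Type} [CommRing R] {A B C : Type} [AddCommGroup A] [Module R A]
  [AddCommGroup B] [Module R B] [AddCommGroup C] [Module R C]
  {f : A →ₗ[R] B} {g : B →ₗ[R] C}

lemma shortExact_of_linearMap (hf : Function.Injective f) (hg : Function.Surjective g)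
    (h : Function.Exact f g) :
    (ModuleCat.shortComplexOfCompEqZero f g h.linearMap_comp_eq_zero).ShortExact :=
  ModuleCat.shortComplex_shortExact _ h hf hg

lemma ExtVanishes.of_exact_middle (hf : Function.Injective f) (hg : Function.Surjective g)
    (h : Function.Exact f g) {i : ℕ} (hA : ExtVanishes R i A) (hC : ExtVanishes R i C) :
    ExtVanishes R i B := by
  have hS := shortExact_of_linearMap hf hg h
  refine subsingleton_of_forall_eq 0 fun e ↦ ?_
  obtain ⟨y, rfl⟩ := Abelian.Ext.contravariant_sequence_exact₂ hS _ e (hA.elim _ _)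
  rw [hC.elim y 0, Abelian.Ext.comp_zero]

lemma ExtVanishes.of_exact_left (hf : Function.Injective f) (hg : Function.Surjective g)
    (h : Function.Exact f g) {i : ℕ} (hB : ExtVanishes R i B) (hC : ExtVanishes R (i + 1) C) :
    ExtVanishes R i A := by
  have hS := shortExact_of_linearMap hf hg h
  refine subsingleton_of_forall_eq 0 fun e ↦ ?_
  obtain ⟨y, rfl⟩ := Abelian.Ext.contravariant_sequence_exact₁ hS _ e (add_comm 1 i)
    (hC.elim _ _)
  rw [hB.elim y 0, Abelian.Ext.comp_zero]

lemma ExtVanishes.of_exact_right (hf : Function.Injective f) (hg : Function.Surjective g)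
    (h : Function.Exact f g) {i : ℕ} (hA : ExtVanishes R i A) (hB : ExtVanishes R (i + 1) B) :
    ExtVanishes R (i + 1) C := by
  have hS := shortExact_of_linearMap hf hg h
  refine subsingleton_of_forall_eq 0 fun e ↦ ?_
  obtain ⟨y, rfl⟩ := Abelian.Ext.contravariant_sequence_exact₃ hS _ e (hB.elim _ _)
    (add_comm 1 i)
  rw [hA.elim y 0, Abelian.Ext.comp_zero]

lemma ExtVanishes.dualMap_surjective (hf : Function.Injective f) (hg : Function.Surjective g)
    (h : Function.Exact f g) (hC : ExtVanishes R 1 C) : Function.Surjective f.dualMap := by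
  have hS := shortExact_of_linearMap hf hg h
  intro φ
  obtain ⟨y, hy⟩ := Abelian.Ext.contravariant_sequence_exact₁ hS _
    (Abelian.Ext.mk₀ (ModuleCat.ofHom φ)) (add_comm 1 0) (hC.elim _ _)
  obtain ⟨ψ, rfl⟩ := (Abelian.Ext.mk₀_bijective _ _).surjective y
  rw [Abelian.Ext.mk₀_comp_mk₀] at hy
  have := (Abelian.Ext.mk₀_bijective _ _).injective hy
  exact ⟨ψ.hom, congrArg ModuleCat.Hom.hom this⟩

lemma ExtVanishes.one_of_dualMap_surjective (hf : Function.Injective f)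
    (hg : Function.Surjective g) (h : Function.Exact f g)
    (hfd : Function.Surjective f.dualMap) (hB : ExtVanishes R 1 B) : ExtVanishes R 1 C := by
  have hS := shortExact_of_linearMap hf hg h
  refine subsingleton_of_forall_eq 0 fun e ↦ ?_
  obtain ⟨y, rfl⟩ := Abelian.Ext.contravariant_sequence_exact₃ hS _ e (hB.elim _ _)
    (add_comm 1 0)
  obtain ⟨φ, rfl⟩ := (Abelian.Ext.mk₀_bijective _ _).surjective y
  obtain ⟨ψ, hψ⟩ := hfd φ.hom
  have hφ : φ = ModuleCat.ofHom f ≫ ModuleCat.ofHom ψ := by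
    ext1
    exact hψ.symm
  rw [hφ, ← Abelian.Ext.mk₀_comp_mk₀]
  exact hS.extClass_comp_assoc _

lemma extVanishes_of_projective [Module.Projective R A] (i : ℕ) : ExtVanishes R (i + 1) A :=
  have : Projective (ModuleCat.of R A) := (IsProjective.iff_projective A).1 inferInstance
  Abelian.Ext.subsingleton_of_projective _ _ _

lemma subsingleton_of_smul_surjective [IsLocalRing R] [Module.Finite R A] {x : R}
    (hx : x ∈ maximalIdeal R) (h : ∀ a : A, ∃ b, x • b = a) : Subsingleton A := by
  rw [← Submodule.subsingleton_iff R, ← subsingleton_iff_bot_eq_top, eq_comm]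
  refine Submodule.eq_bot_of_le_smul_of_le_jacobson_bot (Ideal.span {x}) ⊤ Module.Finite.fg_top
    (fun a _ ↦ ?_) ?_
  · obtain ⟨b, rfl⟩ := h a
    exact Submodule.smul_mem_smul (Ideal.mem_span_singleton_self x) trivial
  · rw [IsLocalRing.jacobson_eq_maximalIdeal _ bot_ne_top]
    simpa using hx

lemma extVanishes_of_smul_comp_surjective [IsLocalRing R] [IsNoetherianRing R] [Module.Finite R A]
    {x : R} (hx : x ∈ maximalIdeal R) {i : ℕ}
    (h : ∀ e : Abelian.Ext.{0} (ModuleCat.of R A) (ModuleCat.of R R) i,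
      ∃ b : Abelian.Ext.{0} (ModuleCat.of R A) (ModuleCat.of R R) i,
        (Abelian.Ext.mk₀ (ModuleCat.ofHom (x • LinearMap.id))).comp b (zero_add i) = e) :
    ExtVanishes R i A := by
  refine subsingleton_of_smul_surjective hx fun e ↦ ?_
  obtain ⟨b, rfl⟩ := h e
  refine ⟨b, ?_⟩
  have : ModuleCat.ofHom (x • LinearMap.id : A →ₗ[R] A) = x • 𝟙 (ModuleCat.of R A) := rfl
  rw [this, Abelian.Ext.mk₀_smul, Abelian.Ext.smul_comp, Abelian.Ext.mk₀_id_comp]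

lemma ExtVanishes.of_smul_quotient [IsLocalRing R] [IsNoetherianRing R] [Module.Finite R C]
    (hf : Function.Injective f) (hg : Function.Surjective g) (h : Function.Exact f g)
    {x : R} (hx : x ∈ maximalIdeal R) {j : C →ₗ[R] B} {r : B →ₗ[R] C}
    (hr : r ∘ₗ j = LinearMap.id) (hj : g ∘ₗ j = x • LinearMap.id) {i : ℕ}
    (hA : ExtVanishes R i A) : ExtVanishes R i C := by
  have hS := shortExact_of_linearMap hf hg h
  refine extVanishes_of_smul_comp_surjective hx fun e ↦ ?_
  obtain ⟨b, hb⟩ := Abelian.Ext.contravariant_sequence_exact₂ hS _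
    ((Abelian.Ext.mk₀ (ModuleCat.ofHom r)).comp e (zero_add i)) (hA.elim _ _)
  refine ⟨b, ?_⟩
  rw [← hj, ModuleCat.ofHom_comp, ← Abelian.Ext.mk₀_comp_mk₀_assoc]
  refine (congrArg (fun t ↦ (Abelian.Ext.mk₀ (ModuleCat.ofHom j)).comp t (zero_add i)) hb).trans ?_
  rw [Abelian.Ext.mk₀_comp_mk₀_assoc, ← ModuleCat.ofHom_comp, hr]
  exact Abelian.Ext.mk₀_id_comp e

lemma ExtVanishes.of_smul_sub [IsLocalRing R] [IsNoetherianRing R] [Module.Finite R A]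
    (hf : Function.Injective f) (hg : Function.Surjective g) (h : Function.Exact f g)
    {F : Type} [AddCommGroup F] [Module R F]
    {x : R} (hx : x ∈ maximalIdeal R) {p₁ : B →ₗ[R] F} {j₁ : F →ₗ[R] B} {p₂ : B →ₗ[R] A}
    {j₂ : A →ₗ[R] B} (hid : j₁ ∘ₗ p₁ + j₂ ∘ₗ p₂ = LinearMap.id)
    (hp : p₂ ∘ₗ f = x • LinearMap.id) {i : ℕ}
    (hF : ExtVanishes R i F) (hC : ExtVanishes R (i + 1) C) : ExtVanishes R i A := by
  have hS := shortExact_of_linearMap hf hg h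
  refine extVanishes_of_smul_comp_surjective hx fun e ↦ ?_
  obtain ⟨b, rfl⟩ := Abelian.Ext.contravariant_sequence_exact₁ hS _ e (add_comm 1 i)
    (hC.elim _ _)
  have hb : b = (Abelian.Ext.mk₀ (ModuleCat.ofHom p₂)).comp
      ((Abelian.Ext.mk₀ (ModuleCat.ofHom j₂)).comp b (zero_add i)) (zero_add i) := by
    conv_lhs => rw [← Abelian.Ext.mk₀_id_comp b]
    have : 𝟙 (ModuleCat.of R B) = ModuleCat.ofHom p₁ ≫ ModuleCat.ofHom j₁ +
        ModuleCat.ofHom p₂ ≫ ModuleCat.ofHom j₂ := by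
      ext1
      exact hid.symm
    refine (congrArg (fun t ↦ (Abelian.Ext.mk₀ t).comp b (zero_add i)) this).trans ?_
    rw [Abelian.Ext.mk₀_add, Abelian.Ext.add_comp, ← Abelian.Ext.mk₀_comp_mk₀_assoc,
      hF.elim ((Abelian.Ext.mk₀ (ModuleCat.ofHom j₁)).comp b (zero_add i)) 0,
      Abelian.Ext.comp_zero, zero_add, Abelian.Ext.mk₀_comp_mk₀_assoc]
  refine ⟨(Abelian.Ext.mk₀ (ModuleCat.ofHom j₂)).comp b (zero_add i), ?_⟩
  rw [← hp, ModuleCat.ofHom_comp, ← Abelian.Ext.mk₀_comp_mk₀_assoc]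
  exact congrArg (fun t ↦ (Abelian.Ext.mk₀ (ModuleCat.ofHom f)).comp t (zero_add i)) hb.symm

end LongExactSequence

lemma isTotallyReflexive_iff (R : Type) [CommRing R] (A : Type) [AddCommGroup A] [Module R A] :
    IsTotallyReflexive R A ↔ Module.Finite R A ∧ Function.Bijective (Module.Dual.eval R A) ∧
      (∀ i, ExtVanishes R (i + 1) A) ∧ ∀ i, ExtVanishes R (i + 1) (Module.Dual R A) := by
  have key (B : Type) [AddCommGroup B] [Module R B] :
      (∀ i > 0, Subsingleton (ExtGroup R i (ModuleCat.of R B) (ModuleCat.of R R))) ↔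
        ∀ i, ExtVanishes R (i + 1) B := by
    constructor
    · exact fun h i ↦ (subsingleton_extGroup_succ_iff _ _ i).1 (h _ i.succ_pos)
    · rintro h (_ | i) hi
      · exact absurd hi (lt_irrefl _)
      · exact (subsingleton_extGroup_succ_iff _ _ i).2 (h i)
  rw [IsTotallyReflexive, key, key]

section TotallyReflexive

variable {R : Type} [CommRing R] {A B C : Type} [AddCommGroup A] [Module R A]
  [AddCommGroup B] [Module R B] [AddCommGroup C] [Module R C]

lemma dualMap_exact {f : A →ₗ[R] B} {g : B →ₗ[R] C} (hg : Function.Surjective g)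
    (h : Function.Exact f g) : Function.Exact g.dualMap f.dualMap := by
  intro φ
  constructor
  · intro hφ
    refine (LinearMap.range_dualMap_eq_dualAnnihilator_ker_of_surjective g hg).ge ?_
    rw [Submodule.mem_dualAnnihilator]
    intro b hb
    obtain ⟨a, rfl⟩ := (h b).1 hb
    exact LinearMap.congr_fun hφ a
  · rintro ⟨ψ, rfl⟩
    ext a
    simp [h.apply_apply_eq_zero]

lemma IsTotallyReflexive.of_projective [Module.Finite R A] [Module.Projective R A] :
    IsTotallyReflexive R A :=
  (isTotallyReflexive_iff R A).2 ⟨inferInstance, Module.bijective_dual_eval R A,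
    extVanishes_of_projective, extVanishes_of_projective⟩

lemma IsTotallyReflexive.of_exact [IsNoetherianRing R] {f : A →ₗ[R] B} {g : B →ₗ[R] C}
    (hf : Function.Injective f) (hg : Function.Surjective g) (h : Function.Exact f g)
    (hB : IsTotallyReflexive R B) (hC : IsTotallyReflexive R C) : IsTotallyReflexive R A := by
  rw [isTotallyReflexive_iff] at hB hC ⊢
  obtain ⟨_, hB₁, hB₂, hB₃⟩ := hB
  obtain ⟨_, hC₁, hC₂, hC₃⟩ := hC
  have hfd : Function.Surjective f.dualMap := (hC₂ 0).dualMap_surjective hf hg h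
  have hgd : Function.Injective g.dualMap := LinearMap.dualMap_injective_of_surjective hg
  have hd := dualMap_exact hg h
  refine ⟨Module.Finite.of_injective f hf, ⟨?_, ?_⟩, fun i ↦ (hB₂ i).of_exact_left hf hg h (hC₂ _),
    ?_⟩
  · rw [injective_iff_map_eq_zero]
    intro a ha
    refine hf (hB₁.1 ?_)
    ext β
    simpa using LinearMap.congr_fun ha (f.dualMap β)
  · intro φ
    obtain ⟨b, hb⟩ := hB₁.2 (φ ∘ₗ f.dualMap)
    have hb' (β : Module.Dual R B) : φ (f.dualMap β) = β b := (LinearMap.congr_fun hb β).symm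
    have hgb : g b = 0 := by
      refine hC₁.1 ?_
      ext γ
      have := hb' (g.dualMap γ)
      rw [hd.apply_apply_eq_zero, map_zero] at this
      simpa using this.symm
    obtain ⟨a, rfl⟩ := (h b).1 hgb
    refine ⟨a, ?_⟩
    ext α
    obtain ⟨β, rfl⟩ := hfd α
    simp [hb']
  · rintro (_ | i)
    · refine ExtVanishes.one_of_dualMap_surjective hgd hfd hd (fun φ ↦ ?_) (hB₃ 0)
      obtain ⟨c, rfl⟩ := hC₁.2 φ
      obtain ⟨b, rfl⟩ := hg c
      exact ⟨Module.Dual.eval R B b, rfl⟩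
    · exact (hC₃ i).of_exact_right hgd hfd hd (hB₃ _)

lemma IsTotallyReflexive.congr [IsNoetherianRing R] (e : A ≃ₗ[R] B)
    (hA : IsTotallyReflexive R A) : IsTotallyReflexive R B := by
  refine .of_exact (C := PUnit.{1}) (f := e.symm.toLinearMap) (g := 0) e.symm.injective
    (fun _ ↦ ⟨0, rfl⟩) (fun a ↦ ?_) hA .of_projective
  simp

lemma IsTotallyReflexive.prod (hA : IsTotallyReflexive R A) (hB : IsTotallyReflexive R B) :
    IsTotallyReflexive R (A × B) := by
  rw [isTotallyReflexive_iff] at hA hB ⊢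
  obtain ⟨_, hA₁, hA₂, hA₃⟩ := hA
  obtain ⟨_, hB₁, hB₂, hB₃⟩ := hB
  have hex : Function.Exact (LinearMap.inl R A B) (LinearMap.snd R A B) :=
    LinearMap.exact_iff.2 (LinearMap.ker_snd ..)
  have hfd : Function.Surjective (LinearMap.inl R A B).dualMap :=
    (hB₂ 0).dualMap_surjective LinearMap.inl_injective LinearMap.snd_surjective hex
  refine ⟨inferInstance, ⟨?_, ?_⟩, fun i ↦ (hA₂ i).of_exact_middle LinearMap.inl_injective
    LinearMap.snd_surjective hex (hB₂ i), fun i ↦ (hB₃ i).of_exact_middle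
    (LinearMap.dualMap_injective_of_surjective LinearMap.snd_surjective) hfd
    (dualMap_exact LinearMap.snd_surjective hex) (hA₃ i)⟩
  · rw [injective_iff_map_eq_zero]
    rintro ⟨a, b⟩ h
    refine Prod.ext (hA₁.1 ?_) (hB₁.1 ?_)
    · ext α
      simpa using LinearMap.congr_fun h ((LinearMap.fst R A B).dualMap α)
    · ext β
      simpa using LinearMap.congr_fun h ((LinearMap.snd R A B).dualMap β)
  · intro φ
    obtain ⟨a, ha⟩ := hA₁.2 (φ ∘ₗ (LinearMap.fst R A B).dualMap)
    obtain ⟨b, hb⟩ := hB₁.2 (φ ∘ₗ (LinearMap.snd R A B).dualMap)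
    refine ⟨(a, b), ?_⟩
    ext γ
    have h₁ : γ (a, 0) = φ (γ ∘ₗ LinearMap.inl R A B ∘ₗ LinearMap.fst R A B) :=
      LinearMap.congr_fun ha (γ ∘ₗ LinearMap.inl R A B)
    have h₂ : γ (0, b) = φ (γ ∘ₗ LinearMap.inr R A B ∘ₗ LinearMap.snd R A B) :=
      LinearMap.congr_fun hb (γ ∘ₗ LinearMap.inr R A B)
    calc γ (a, b) = γ (a, 0) + γ (0, b) := by rw [← map_add]; simp
      _ = φ γ := by
        rw [h₁, h₂, ← map_add]
        congr 1
        ext <;> simp <;> exact map_zero γ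

end TotallyReflexive

/-- The kernel of `F × N → N`, `(v, n) ↦ π v + x n`: when `π` is surjective, this is the extension
of `N` by `ker π` obtained by multiplying the class of `π` by `-x`. -/
abbrev twistedExtension {R F N : Type} [CommRing R] [AddCommGroup F] [Module R F]
    [AddCommGroup N] [Module R N] (π : F →ₗ[R] N) (x : R) : Submodule R (F × N) :=
  LinearMap.ker (π.coprod (x • LinearMap.id))

section TwistedExtension

variable {R F N : Type} [CommRing R] [AddCommGroup F] [Module R F] [AddCommGroup N] [Module R N]
  {π : F →ₗ[R] N} {x : R}

lemma isTotallyReflexive_of_twistedExtension [IsLocalRing R] [IsNoetherianRing R]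
    [Module.Finite R F] [Module.Projective R F] [Module.Finite R N]
    (hπ : Function.Surjective π) (hx : x ∈ maximalIdeal R)
    (hX : IsTotallyReflexive R (twistedExtension π x)) : IsTotallyReflexive R N := by
  rw [isTotallyReflexive_iff] at hX ⊢
  obtain ⟨_, hX₁, hX₂, hX₃⟩ := hX
  set g : F × N →ₗ[R] N := π.coprod (x • LinearMap.id) with hg_def
  have g_apply (v : F) (n : N) : g (v, n) = π v + x • n := by simp [hg_def]
  set ι := (twistedExtension π x).subtype
  have hι : Function.Injective ι := Subtype.val_injective
  have hg : Function.Surjective g := fun n ↦ by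
    obtain ⟨v, rfl⟩ := hπ n
    exact ⟨(v, 0), by simp [g_apply]⟩
  have hex : Function.Exact ι g := LinearMap.exact_subtype_ker_map g
  have hgr : g ∘ₗ LinearMap.inr R F N = x • LinearMap.id := LinearMap.coprod_inr _ _
  have hN (i : ℕ) : ExtVanishes R (i + 1) N :=
    (hX₂ i).of_smul_quotient hι hg hex hx (LinearMap.snd_comp_inr R F N) hgr
  have hιd : Function.Surjective ι.dualMap := (hN 0).dualMap_surjective hι hg hex
  have hgd : Function.Injective g.dualMap := LinearMap.dualMap_injective_of_surjective hg
  have hd : Function.Exact g.dualMap ι.dualMap := dualMap_exact hg hex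
  refine ⟨inferInstance, ⟨?_, ?_⟩, hN, fun i ↦ ?_⟩
  · have : Subsingleton (LinearMap.ker (Module.Dual.eval R N)) := by
      refine subsingleton_of_smul_surjective hx ?_
      rintro ⟨n, hn⟩
      obtain ⟨⟨v₀, n₀⟩, rfl⟩ := hg n
      have hle : LinearMap.ker ι.dualMap ≤
          LinearMap.ker (Module.Dual.eval R (F × N) (v₀, n₀)) := by
        intro β hβ
        obtain ⟨α, rfl⟩ := (hd β).1 hβ
        exact LinearMap.congr_fun hn α
      obtain ⟨χ, hχ⟩ : ∃ χ : Module.Dual R (Module.Dual R (twistedExtension π x)),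
          χ ∘ₗ ι.dualMap = Module.Dual.eval R (F × N) (v₀, n₀) :=
        ⟨(LinearMap.ker ι.dualMap).liftQ _ hle ∘ₗ
          (ι.dualMap.quotKerEquivOfSurjective hιd).symm.toLinearMap, by
            ext1 β
            have : (ι.dualMap.quotKerEquivOfSurjective hιd).symm (ι.dualMap β) =
              (LinearMap.ker ι.dualMap).mkQ β := by
              rw [LinearEquiv.symm_apply_eq]
              rfl
            change (LinearMap.ker ι.dualMap).liftQ _ hle
              ((ι.dualMap.quotKerEquivOfSurjective hιd).symm (ι.dualMap β)) = _
            rw [this]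
            rfl⟩
      obtain ⟨w, rfl⟩ := hX₁.2 χ
      have hw (β : Module.Dual R (F × N)) : β (v₀, n₀) = β (ι w) :=
        (LinearMap.congr_fun hχ β).symm
      have hF : v₀ = (ι w).1 := by
        refine (Module.bijective_dual_eval R F).1 ?_
        ext β
        exact hw (β ∘ₗ LinearMap.fst R F N)
      refine ⟨⟨n₀ - (ι w).2, ?_⟩, ?_⟩
      · rw [LinearMap.mem_ker]
        ext β
        have := hw (β ∘ₗ LinearMap.snd R F N)
        simpa [sub_eq_zero] using this
      · ext
        have h₁ : g (ι w) = 0 := w.2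
        rw [← Prod.mk.eta (p := ι w), g_apply, ← hF] at h₁
        simp only [SetLike.mk_smul_mk, g_apply, smul_sub]
        rw [eq_neg_of_add_eq_zero_left h₁]
        abel
    rw [← LinearMap.ker_eq_bot]
    exact (Submodule.subsingleton_iff_eq_bot).1 this
  · rw [← LinearMap.range_eq_top, eq_top_iff]
    refine Submodule.le_of_le_smul_of_le_jacobson_bot (I := maximalIdeal R) Module.Finite.fg_top
      (IsLocalRing.jacobson_eq_maximalIdeal _ bot_ne_top).ge fun φ _ ↦ ?_
    obtain ⟨ψ, rfl⟩ := (hX₃ 0).dualMap_surjective hgd hιd hd φ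
    obtain ⟨v, hv⟩ := (Module.bijective_dual_eval R F).2 (ψ ∘ₗ (LinearMap.fst R F N).dualMap)
    have : g.dualMap.dualMap ψ = Module.Dual.eval R N (π v) +
        x • (ψ ∘ₗ (LinearMap.snd R F N).dualMap) := by
      ext α
      have hα : g.dualMap α = (LinearMap.fst R F N).dualMap (α ∘ₗ π) +
          x • (LinearMap.snd R F N).dualMap α := by
        ext <;> simp [hg_def]
      have hv' := LinearMap.congr_fun hv (α ∘ₗ π)
      simp only [Module.Dual.eval_apply, LinearMap.comp_apply] at hv'
      rw [LinearMap.dualMap_apply, hα]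
      simp [hv']
    rw [this]
    exact Submodule.add_mem_sup ⟨_, rfl⟩ (Submodule.smul_mem_smul hx trivial)
  · refine ExtVanishes.of_smul_sub hgd hιd hd (F := Module.Dual R F) hx
      (p₁ := (LinearMap.inl R F N).dualMap) (j₁ := (LinearMap.fst R F N).dualMap)
      (p₂ := (LinearMap.inr R F N).dualMap) (j₂ := (LinearMap.snd R F N).dualMap) ?_ ?_
      (extVanishes_of_projective i) (hX₃ _)
    · ext β <;> simp <;> exact map_zero β
    · ext α n
      simp [hg_def]

end TwistedExtension

/-- `GDimLE R n X`: the module `X` has a resolution of length at most `n` by totally reflexive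
modules. -/
def GDimLE (R : Type) [CommRing R] : ℕ → ModuleCat.{0} R → Prop
  | 0, X => IsTotallyReflexive R X
  | n + 1, X => ∃ (T : ModuleCat.{0} R) (g : T →ₗ[R] X), IsTotallyReflexive R T ∧
      Function.Surjective g ∧ GDimLE R n (ModuleCat.of R (LinearMap.ker g))

section GDimLE

variable {R : Type} [CommRing R]

lemma GDimLE.hasFiniteGDim {n : ℕ} {X : ModuleCat.{0} R} (h : GDimLE R n X) :
    HasFiniteGDim R X := by
  induction n generalizing X with
  | zero =>
    refine ⟨0, fun | 0 => X | _ + 1 => ModuleCat.of R PUnit.{1}, fun _ ↦ 0, LinearMap.id, ?_,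
      Function.surjective_id, by simp, ?_, ?_⟩
    · rintro (_ | i)
      · exact h
      · exact IsTotallyReflexive.of_projective (A := PUnit.{1})
    · intro i
      ext v
      exact ⟨fun _ ↦ ⟨0, (Subsingleton.elim (α := PUnit.{1}) _ _)⟩, fun _ ↦ rfl⟩
    · rintro (_ | i) hi
      · exact absurd hi (lt_irrefl _)
      · exact inferInstanceAs (Subsingleton PUnit.{1})
  | succ n ih =>
    obtain ⟨T₀, g, hT₀, hg, hK⟩ := h
    obtain ⟨m, T, d, ε, hT, hε, hε₀, hd, hm⟩ := ih hK
    let ε' : T 0 →ₗ[R] T₀ := (LinearMap.ker g).subtype ∘ₗ ε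
    have hker : LinearMap.ker ε' = LinearMap.ker ε :=
      LinearMap.ker_comp_of_ker_eq_bot _ (Submodule.ker_subtype _)
    refine ⟨m + 1, fun | 0 => T₀ | i + 1 => T i, fun | 0 => ε' | i + 1 => d i, g, ?_, hg, ?_, ?_,
      ?_⟩
    · rintro (_ | i)
      · exact hT₀
      · exact hT i
    · refine ((LinearMap.range_comp_of_range_eq_top _ (LinearMap.range_eq_top.2 hε)).trans ?_).symm
      exact Submodule.range_subtype _
    · rintro (_ | i)
      · exact hker.trans hε₀
      · exact hd i
    · rintro (_ | i) hi
      · exact absurd hi (Nat.not_lt_zero _)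
      · exact hm i (Nat.lt_of_succ_lt_succ hi)

variable [IsNoetherianRing R]

lemma GDimLE.congr {n : ℕ} {X Y : ModuleCat.{0} R} (e : X ≃ₗ[R] Y) (h : GDimLE R n X) :
    GDimLE R n Y := by
  cases n with
  | zero => exact IsTotallyReflexive.congr e h
  | succ n =>
    obtain ⟨T, g, hT, hg, hK⟩ := h
    refine ⟨T, e.toLinearMap ∘ₗ g, hT, e.surjective.comp hg, ?_⟩
    rwa [LinearEquiv.ker_comp]

lemma HasFiniteGDim.exists_gdimLE {X : ModuleCat.{0} R} (h : HasFiniteGDim R X) :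
    ∃ n, GDimLE R n X := by
  obtain ⟨n, T, d, ε, hT, hε, hε₀, hd, hn⟩ := h
  refine ⟨n, ?_⟩
  induction n generalizing X T with
  | zero =>
    have : LinearMap.ker ε = ⊥ := by
      rw [hε₀, eq_bot_iff]
      rintro _ ⟨v, rfl⟩
      have := (hn 1 one_pos).elim v 0
      simp [this]
    exact (hT 0).congr (LinearEquiv.ofBijective ε ⟨LinearMap.ker_eq_bot.1 this, hε⟩)
  | succ n ih =>
    refine ⟨T 0, ε, hT 0, hε, ?_⟩
    let ε' : T 1 →ₗ[R] LinearMap.ker ε := (d 0).codRestrict _ fun v ↦ hε₀ ▸ ⟨v, rfl⟩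
    refine ih (X := ModuleCat.of R (LinearMap.ker ε)) (fun i ↦ T (i + 1)) (fun i ↦ d (i + 1)) ε'
      (fun i ↦ hT _) ?_ ?_ (fun i ↦ hd _) (fun i hi ↦ hn _ (Nat.succ_lt_succ hi))
    · rintro ⟨v, hv⟩
      rw [hε₀] at hv
      obtain ⟨w, rfl⟩ := hv
      exact ⟨w, rfl⟩
    · rw [← hd 0]
      exact LinearMap.ker_codRestrict _ _ _

lemma GDimLE.ker {n : ℕ} {X T : ModuleCat.{0} R} (h : GDimLE R n X) (hT : IsTotallyReflexive R T)
    {g : X →ₗ[R] T} (hg : Function.Surjective g) :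
    GDimLE R n (ModuleCat.of R (LinearMap.ker g)) := by
  cases n with
  | zero =>
    exact IsTotallyReflexive.of_exact Subtype.val_injective hg (LinearMap.exact_subtype_ker_map g)
      h hT
  | succ n =>
    obtain ⟨S, k, hS, hk, hK⟩ := h
    have hmem (v : LinearMap.ker (g ∘ₗ k)) : k v ∈ LinearMap.ker g := v.2
    refine ⟨ModuleCat.of R (LinearMap.ker (g ∘ₗ k)),
      (k ∘ₗ (LinearMap.ker (g ∘ₗ k)).subtype).codRestrict _ hmem,
      .of_exact (g := g ∘ₗ k) Subtype.val_injective (hg.comp hk)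
        (LinearMap.exact_subtype_ker_map (g ∘ₗ k)) hS hT,
      ?_, ?_⟩
    · rintro ⟨v, hv⟩
      obtain ⟨w, rfl⟩ := hk v
      exact ⟨⟨w, hv⟩, rfl⟩
    · refine hK.congr (Y := ModuleCat.of R _) (LinearEquiv.ofBijective
        ((Submodule.inclusion (LinearMap.ker_le_ker_comp k g)).codRestrict _
          fun v ↦ by exact Subtype.ext v.2) ⟨fun v w hvw ↦ ?_, ?_⟩)
      · exact Subtype.ext (congrArg (fun u ↦ u.1.1) hvw)
      · rintro ⟨v, hv⟩
        exact ⟨⟨v.1, congrArg Subtype.val hv⟩, rfl⟩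

lemma GDimLE.prod {n : ℕ} {X F : ModuleCat.{0} R} (h : GDimLE R n X)
    (hF : IsTotallyReflexive R F) : GDimLE R n (ModuleCat.of R (F × X)) := by
  cases n with
  | zero => exact hF.prod h
  | succ n =>
    obtain ⟨T, g, hT, hg, hK⟩ := h
    refine ⟨ModuleCat.of R (F × T), LinearMap.prodMap LinearMap.id g, hF.prod hT,
      Function.surjective_id.prodMap hg, hK.congr (Y := ModuleCat.of R _) ?_⟩
    refine LinearEquiv.ofBijective (((LinearMap.inr R F T) ∘ₗ (LinearMap.ker g).subtype).codRestrict
      _ fun v ↦ ?_) ⟨fun v w hvw ↦ ?_, ?_⟩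
    · simp
    · exact Subtype.ext (congrArg (fun u ↦ u.1.2) hvw)
    · rintro ⟨⟨v, t⟩, hv⟩
      obtain ⟨rfl, ht⟩ : v = 0 ∧ g t = 0 := by simpa using hv
      exact ⟨⟨t, ht⟩, rfl⟩

lemma GDimLE.ker_of_projective {n : ℕ} {X F : ModuleCat.{0} R} (h : GDimLE R (n + 1) X)
    [Module.Finite R F] [Module.Projective R F] {f : F →ₗ[R] X} (hf : Function.Surjective f) :
    GDimLE R n (ModuleCat.of R (LinearMap.ker f)) := by
  obtain ⟨T, g, hT, hg, hK⟩ := h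
  obtain ⟨s, hs⟩ := Module.projective_lifting_property g f hg
  have hs' (v : F) : g (s v) = f v := LinearMap.congr_fun hs v
  let Φ : (F × LinearMap.ker g) →ₗ[R] T := s.coprod (LinearMap.ker g).subtype
  have hΦ : Function.Surjective Φ := fun t ↦ by
    obtain ⟨v, hv⟩ := hf (g t)
    exact ⟨(v, ⟨t - s v, by simp [hs', hv]⟩), by simp [Φ]⟩
  have hK' := (hK.prod (F := F) .of_projective).ker hT (g := Φ) hΦ
  refine hK'.congr (Y := ModuleCat.of R _) ?_
  refine LinearEquiv.ofBijective ((LinearMap.fst R F _ ∘ₗ (LinearMap.ker Φ).subtype).codRestrict _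
    ?_) ⟨?_, ?_⟩
  · rintro ⟨⟨v, k⟩, hv⟩
    have hv' : s v + k = 0 := hv
    have := congrArg g hv'
    simpa [hs'] using this
  · rintro ⟨⟨v, k⟩, hv⟩ ⟨⟨w, l⟩, hw⟩ hvw
    obtain rfl : v = w := congrArg Subtype.val hvw
    have hv' : s v + k = 0 := hv
    have hw' : s v + l = 0 := hw
    simpa using hv'.trans hw'.symm
  · rintro ⟨v, hv⟩
    refine ⟨⟨(v, ⟨-s v, ?_⟩), ?_⟩, rfl⟩
    · simpa [hs'] using hv
    · simp [Φ]

lemma exists_gdimLE_of_twistedExtension [IsLocalRing R] {x : R} (hx : x ∈ maximalIdeal R)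
    {n : ℕ} {N F : ModuleCat.{0} R} [Module.Finite R N] [Module.Finite R F]
    [Module.Projective R F] {π : F →ₗ[R] N} (hπ : Function.Surjective π)
    (h : GDimLE R n (ModuleCat.of R (twistedExtension π x))) : ∃ k, GDimLE R k N := by
  induction n generalizing N F with
  | zero => exact ⟨0, isTotallyReflexive_of_twistedExtension hπ hx h⟩
  | succ n ih =>
    obtain ⟨m, ρ, hρ⟩ := Module.Finite.exists_fin' R (LinearMap.ker π)
    have hπ₀ (k : LinearMap.ker π) : π k = 0 := k.2
    let Ψ : ((Fin m → R) × F) →ₗ[R] twistedExtension π x :=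
      (((LinearMap.ker π).subtype ∘ₗ ρ ∘ₗ LinearMap.fst R _ _ + x • LinearMap.snd R _ _).prod
        (-π ∘ₗ LinearMap.snd R _ _)).codRestrict _ fun v ↦ by simp [hπ₀]
    have hΨ : Function.Surjective Ψ := by
      rintro ⟨⟨v, y⟩, hv⟩
      have hv' : π v + x • y = 0 := hv
      obtain ⟨e, he⟩ := hπ (-y)
      obtain ⟨l, hl⟩ := hρ ⟨v - x • e, by
        rw [LinearMap.mem_ker, map_sub, map_smul, he, smul_neg, sub_neg_eq_add, hv']⟩
      exact ⟨(l, e), Subtype.ext (Prod.ext (by simp [Ψ, hl]) (by simp [Ψ, he]))⟩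
    have hK := h.ker_of_projective (F := ModuleCat.of R ((Fin m → R) × F)) hΨ
    let ι : twistedExtension ρ x →ₗ[R] LinearMap.ker Ψ :=
      (LinearMap.prodMap LinearMap.id (LinearMap.ker π).subtype ∘ₗ
        (twistedExtension ρ x).subtype).codRestrict _ <| by
          rintro ⟨⟨l, k⟩, hlk⟩
          have hlk' : ρ l + x • k = 0 := hlk
          exact Subtype.ext (Prod.ext (congrArg Subtype.val hlk') (by simp [Ψ]))
    have hι : Function.Bijective ι := by
      constructor
      · rintro ⟨⟨l, k⟩, hlk⟩ ⟨⟨l', k'⟩, hlk'⟩ heq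
        have h₁ : l = l' := congrArg (fun u ↦ u.1.1) heq
        have h₂ : k = k' := Subtype.ext (congrArg (fun u ↦ u.1.2) heq)
        subst h₁ h₂
        rfl
      · rintro ⟨⟨l, e⟩, hle⟩
        have h₁ : (ρ l : F) + x • e = 0 := congrArg (fun u ↦ u.1.1) hle
        have h₂ : -π e = 0 := congrArg (fun u ↦ u.1.2) hle
        exact ⟨⟨(l, ⟨e, neg_eq_zero.1 h₂⟩), Subtype.ext h₁⟩, rfl⟩
    obtain ⟨k, hk⟩ := ih (N := ModuleCat.of R (LinearMap.ker π)) (F := ModuleCat.of R (Fin m → R))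
      (π := ρ) hρ (hK.congr (Y := ModuleCat.of R _) (LinearEquiv.ofBijective ι hι).symm)
    exact ⟨k + 1, F, π, .of_projective, hπ, hk⟩

end GDimLE


section FreeLocus

variable {R : Type} [CommRing R] {A B C : Type} [AddCommGroup A] [Module R A]
  [AddCommGroup B] [Module R B] [AddCommGroup C] [Module R C]

open TensorProduct in
lemma mem_freeLocus_prod {p : PrimeSpectrum R} (hA : p ∈ Module.freeLocus R A)
    (hB : p ∈ Module.freeLocus R B) : p ∈ Module.freeLocus R (A × B) := by
  let Rp := Localization.AtPrime p.asIdeal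
  rw [Module.mem_freeLocus_iff_tensor p Rp] at *
  exact Module.Free.of_equiv (TensorProduct.prodRight R Rp Rp A B).symm

open TensorProduct in
lemma mem_freeLocus_of_exact [Module.Finite R A] {f : A →ₗ[R] B} {g : B →ₗ[R] C}
    (hf : Function.Injective f) (hg : Function.Surjective g) (h : Function.Exact f g)
    {p : PrimeSpectrum R} (hB : p ∈ Module.freeLocus R B) (hC : p ∈ Module.freeLocus R C) :
    p ∈ Module.freeLocus R A := by
  let Rp := Localization.AtPrime p.asIdeal
  rw [Module.mem_freeLocus_iff_tensor p Rp] at *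
  let f' := f.baseChange Rp
  let g' := g.baseChange Rp
  have hf' : Function.Injective f' := Module.Flat.lTensor_preserves_injective_linearMap f hf
  have hg' : Function.Surjective g' := LinearMap.lTensor_surjective Rp hg
  have h' : Function.Exact f' g' := lTensor_exact Rp h hg
  obtain ⟨s, hs⟩ := Module.projective_lifting_property g' LinearMap.id hg'
  obtain ⟨r, hr⟩ := ((h'.split_tfae hf' hg').out 0 1 rfl rfl).1 ⟨s, hs⟩
  have : Module.Projective Rp (Rp ⊗[R] A) := .of_split f' r hr
  exact Module.free_of_flat_of_isLocalRing

lemma mem_freeLocus_of_smul_bijective (f : A →ₗ[R] B) {x : R} {p : PrimeSpectrum R}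
    (hx : x ∉ p.asIdeal) (hker : ∀ a, f a = 0 → x • a = 0) (hcoker : ∀ b, ∃ a, f a = x • b)
    (hB : p ∈ Module.freeLocus R B) : p ∈ Module.freeLocus R A := by
  let S := p.asIdeal.primeCompl
  let x' : S := ⟨x, hx⟩
  let φ := LocalizedModule.mkLinearMap S B
  have : IsLocalizedModule S (φ ∘ₗ f) :=
    { map_units := IsLocalizedModule.map_units φ
      surj := fun y ↦ by
        obtain ⟨⟨b, s⟩, hb⟩ := IsLocalizedModule.surj S φ y
        obtain ⟨a, ha⟩ := hcoker b
        refine ⟨⟨a, x' * s⟩, ?_⟩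
        simp only [mul_smul, hb, LinearMap.comp_apply, ha, map_smul]
        rfl
      exists_of_eq := fun {a₁ a₂} h ↦ by
        obtain ⟨s, hs⟩ := IsLocalizedModule.exists_of_eq (S := S) (f := φ) h
        refine ⟨x' * s, ?_⟩
        have := hker ((s : R) • (a₁ - a₂)) (by
          rw [map_smul, map_sub, smul_sub, sub_eq_zero]; exact hs)
        rw [smul_sub, smul_sub, sub_eq_zero] at this
        rw [mul_smul, mul_smul]
        exact this }
  rw [Module.mem_freeLocus_of_isLocalization p (Localization.AtPrime p.asIdeal) _ (φ ∘ₗ f)]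
  exact hB

lemma freeLocus_subset_twistedExtension {F N : Type} [AddCommGroup F] [Module R F]
    [AddCommGroup N] [Module R N] [IsNoetherianRing R] [Module.Finite R F] [Module.Projective R F]
    [Module.Finite R N] {π : F →ₗ[R] N} (hπ : Function.Surjective π) (x : R) :
    Module.freeLocus R N ⊆ Module.freeLocus R (twistedExtension π x) := fun p hp ↦ by
  refine mem_freeLocus_of_exact (f := (twistedExtension π x).subtype)
    (g := π.coprod (x • LinearMap.id)) Subtype.val_injective (fun n ↦ ?_)
    (LinearMap.exact_subtype_ker_map _) (mem_freeLocus_prod ?_ hp) hp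
  · obtain ⟨v, rfl⟩ := hπ n
    exact ⟨(v, 0), by simp⟩
  · simp [Module.freeLocus_eq_univ]

lemma mem_freeLocus_twistedExtension {F N : Type} [AddCommGroup F] [Module R F]
    [AddCommGroup N] [Module R N] [Module.Finite R F] [Module.Projective R F]
    (π : F →ₗ[R] N) {x : R} {p : PrimeSpectrum R}
    (hx : x ∉ p.asIdeal) : p ∈ Module.freeLocus R (twistedExtension π x) := by
  refine mem_freeLocus_of_smul_bijective
    (LinearMap.fst R F N ∘ₗ (twistedExtension π x).subtype) hx ?_ (fun v ↦ ?_)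
    (by simp [Module.freeLocus_eq_univ])
  · rintro ⟨⟨v, n⟩, h⟩ (rfl : v = 0)
    ext1
    simpa using h
  · exact ⟨⟨(x • v, -π v), by simp⟩, rfl⟩

end FreeLocus

section Depth

variable {R : Type} [CommRing R] [IsLocalRing R] [IsNoetherianRing R]

/-- A finitely generated module has positive depth if and only if it has no nonzero element
annihilated by the maximal ideal. -/
lemma rdepth_pos_iff {A : Type} [AddCommGroup A] [Module R A] [Module.Finite R A] :
    0 < rdepth R A ↔ ∀ a : A, (∀ r ∈ maximalIdeal R, r • a = 0) → a = 0 := by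
  rcases subsingleton_or_nontrivial A with hA | hA
  · simp [rdepth, hA, Subsingleton.elim _ (0 : A)]
  rw [rdepth, if_neg (not_subsingleton A), lt_sSup_iff]
  constructor
  · rintro ⟨n, ⟨rs, rfl, hrs, hreg⟩, hn⟩ a ha
    match rs, hn with
    | r :: rs, _ =>
      rw [RingTheory.Sequence.isRegular_cons_iff] at hreg
      exact hreg.1 (by simpa using ha r (hrs r (by simp)))
  · intro h
    obtain ⟨r, hr, hr'⟩ : ∃ r ∈ maximalIdeal R, r ∉ ⋃ p ∈ associatedPrimes R A, (p : Set R) := by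
      by_contra! hcon
      obtain ⟨P, hP, hle⟩ := (Ideal.subset_union_prime_finite
        (associatedPrimes.finite R A) (f := id) 0 0
        (fun P hP _ _ ↦ hP.isPrime)).1 hcon
      obtain ⟨hP, a, rfl⟩ := (isAssociatedPrime_iff).1 hP
      have : a = 0 := h a fun r hr ↦ by simpa [Submodule.mem_colon_singleton] using hle hr
      exact hP.ne_top (by simp [this])
    rw [biUnion_associatedPrimes_eq_zero_divisors] at hr'
    refine ⟨1, ⟨[r], rfl, by simpa using hr, ?_⟩, zero_lt_one⟩
    rw [IsLocalRing.isRegular_iff_isWeaklyRegular_of_subset_maximalIdeal (by simpa using hr),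
      RingTheory.Sequence.isWeaklyRegular_singleton_iff]
    refine (isSMulRegular_iff_right_eq_zero_of_smul).2 fun a ha ↦ ?_
    by_contra ha'
    exact hr' ⟨a, ha', ha⟩

lemma rdepth_twistedExtension_pos {N : Type} [AddCommGroup N] [Module R N] [Module.Finite R N]
    {m : ℕ} (π : (Fin m → R) →ₗ[R] N) (x : R) (hR : 0 < rdepth R R) (hN : 0 < rdepth R N) :
    0 < rdepth R (twistedExtension π x) := by
  rw [rdepth_pos_iff] at *
  rintro ⟨⟨v, n⟩, h⟩ ha
  have h0 (r) (hr : r ∈ maximalIdeal R) : r • v = 0 ∧ r • n = 0 := by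
    simpa using congrArg Subtype.val (ha r hr)
  have hv : v = 0 := funext fun i ↦ hR _ fun r hr ↦ congrFun (h0 r hr).1 i
  have hn : n = 0 := hN _ fun r hr ↦ (h0 r hr).2
  simp [hv, hn]

end Depth

lemma InResolvingClosure.twistedExtension {R : Type} [CommRing R] {M N : ModuleCat.{0} R}
    (h : InResolvingClosure R M N) {m : ℕ} {π : (Fin m → R) →ₗ[R] N}
    (hπ : Function.Surjective π) (x : R) :
    InResolvingClosure R M (ModuleCat.of R (twistedExtension π x)) := by
  intro P hP hM
  obtain ⟨-, -, -, hext, hsyz⟩ := id hP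
  refine hext (ModuleCat.of R (LinearMap.ker π)) _ N
    (((LinearMap.inl R (Fin m → R) N) ∘ₗ (LinearMap.ker π).subtype).codRestrict _ ?_)
    (LinearMap.snd R (Fin m → R) N ∘ₗ (_root_.twistedExtension π x).subtype) ?_ ?_ ?_
    (hsyz N _ m π hπ ⟨LinearEquiv.refl _ _⟩ (h P hP hM)) (h P hP hM)
  · rintro ⟨v, hv⟩
    simpa using hv
  · intro a b hab
    exact Subtype.ext (congrArg (fun z ↦ z.1.1) hab)
  · intro n
    obtain ⟨v, hv⟩ := hπ (-(x • n))
    exact ⟨⟨(v, n), by simp [hv]⟩, rfl⟩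
  · ext ⟨⟨v, n⟩, hvn⟩
    constructor
    · rintro (rfl : n = 0)
      exact ⟨⟨v, by simpa using hvn⟩, rfl⟩
    · rintro ⟨a, ha⟩
      exact (congrArg (fun z ↦ z.1.2) ha).symm

/-- a module of positive depth and infinite G-dimension over a local ring
of positive depth has, in its resolving closure, a module which is locally free on the
punctured spectrum, of positive depth and of infinite G-dimension. -/
theorem stmt18 (R : Type) [CommRing R] [IsLocalRing R] [IsNoetherianRing R]
    (hR : 0 < rdepth R R)
    (M : ModuleCat.{0} R) (hM : Module.Finite R M)
    (hdepth : 0 < rdepth R M) (hG : ¬ HasFiniteGDim R M) :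
    ∃ N : ModuleCat.{0} R, InResolvingClosure R M N ∧ Module.Finite R N ∧
      (∀ (p : Ideal R) [p.IsPrime], p ≠ maximalIdeal R →
        Module.Free (Localization.AtPrime p) (LocalizedModule p.primeCompl N)) ∧
      0 < rdepth R N ∧ ¬ HasFiniteGDim R N := by
  let Q (U : TopologicalSpace.Opens (PrimeSpectrum R)) : Prop := ∃ N : ModuleCat.{0} R,
    InResolvingClosure R M N ∧ Module.Finite R N ∧ 0 < rdepth R N ∧ ¬ HasFiniteGDim R N ∧
      (U : Set _) = Module.freeLocus R N
  have hlocus (N : ModuleCat.{0} R) [Module.Finite R N] : IsOpen (Module.freeLocus R N) :=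
    have := Module.finitePresentation_of_finite R N
    Module.isOpen_freeLocus
  have hne : ∃ U, Q U := ⟨⟨_, hlocus M⟩, M, fun P _ h ↦ h, hM, hdepth, hG, rfl⟩
  obtain ⟨U, ⟨N, hN, hfin, hd, hinf, hU⟩, hmax⟩ := exists_maximal_of_wellFoundedGT Q hne
  refine ⟨N, hN, hfin, fun p hp hpm ↦ ?_, hd, hinf⟩
  by_contra hfree
  let p' : PrimeSpectrum R := ⟨p, hp⟩
  obtain ⟨x, hx, hxp⟩ := SetLike.exists_of_lt ((le_maximalIdeal hp.ne_top).lt_of_ne hpm)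
  obtain ⟨m, π, hπ⟩ := Module.Finite.exists_fin' R N
  let X := ModuleCat.of R (twistedExtension π x)
  have hX : ¬ HasFiniteGDim R X := fun h ↦ by
    obtain ⟨n, hn⟩ := h.exists_gdimLE
    obtain ⟨k, hk⟩ := exists_gdimLE_of_twistedExtension (F := ModuleCat.of R (Fin m → R)) hx hπ hn
    exact hinf hk.hasFiniteGDim
  have hle := hmax (y := ⟨_, hlocus X⟩)
    ⟨X, hN.twistedExtension hπ x, inferInstance, rdepth_twistedExtension_pos π x hR hd, hX, rfl⟩
    (fun q hq ↦ freeLocus_subset_twistedExtension hπ x (hU.le hq))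
  exact hfree (hU.le (hle (mem_freeLocus_twistedExtension (p := p') π hxp)))
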